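/- Let Φ(t) = ((gaussianReal 0 1) {x : x ≤ t}).toReal denote the standard Gaussian cumulative distribution function. Let ε ∈ ℝ, v > 0, α ≥ 0, and let β be any real number. Then for μ = gaussianReal ε v one has (μ {x : |x − ε| ≤ α}).toReal ≥ β if and only if Φ(α/√v) ≥ (1 + β)/2. -/

import Mathlib

open ProbabilityTheory

/-- The cumulative distribution function of the standard Gaussian. -/
noncomputable def stdGaussianCDF (t : ℝ) : ℝ :=
  ((gaussianReal 0 1) {x : ℝ | x ≤ t}).toReal

open MeasureTheory

/-- Standardization: an affine change of variables turns `gaussianReal m v` into the standard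
Gaussian. -/
lemma gaussianReal_map_standardize (m : ℝ) {v : NNReal} (hv : v ≠ 0) :
    (gaussianReal m v).map (fun x ↦ (x - m) / Real.sqrt v) = gaussianReal 0 1 := by
  have h : (fun x : ℝ ↦ (x - m) / Real.sqrt v) = (fun x ↦ x / Real.sqrt v) ∘ (fun x ↦ x - m) := rfl
  rw [h, ← Measure.map_map (by fun_prop) (by fun_prop), gaussianReal_map_sub_const,
    gaussianReal_map_div_const]
  congr 1
  · simp
  · ext
    simp [Real.sq_sqrt, hv]

lemma gaussianReal_real_Iio_neg (v : NNReal) (t : ℝ) :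
    (gaussianReal 0 v).real (Set.Iio (-t)) = (gaussianReal 0 v).real (Set.Ioi t) := by
  have h := gaussianReal_map_neg (μ := 0) (v := v)
  rw [neg_zero] at h
  conv_lhs => rw [← h, map_measureReal_apply measurable_neg measurableSet_Iio]
  congr 1
  ext x
  simp

lemma gaussianReal_real_abs_le {t : ℝ} (ht : 0 ≤ t) :
    (gaussianReal 0 1).real {x | |x| ≤ t} = 2 * stdGaussianCDF t - 1 := by
  have hset : {x : ℝ | |x| ≤ t} = Set.Iic t \ Set.Iio (-t) := by
    ext x
    simp [abs_le, and_comm]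
  have hsub : Set.Iio (-t) ⊆ Set.Iic t := fun x (hx : x < -t) ↦ show x ≤ t by linarith
  have hcdf : stdGaussianCDF t = (gaussianReal 0 1).real (Set.Iic t) := rfl
  rw [hset, measureReal_sdiff hsub measurableSet_Iio, gaussianReal_real_Iio_neg,
    ← Set.compl_Iic, probReal_compl_eq_one_sub measurableSet_Iic, hcdf]
  ring

lemma gaussianReal_real_abs_sub_le (m : ℝ) {v : NNReal} (hv : v ≠ 0) (a : ℝ) :
    (gaussianReal m v).real {x | |x - m| ≤ a} =
      (gaussianReal 0 1).real {x | |x| ≤ a / Real.sqrt v} := by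
  have hs : 0 < Real.sqrt v := Real.sqrt_pos.2 (by positivity)
  rw [← gaussianReal_map_standardize m hv, map_measureReal_apply (by fun_prop)
    (measurableSet_le (by fun_prop) (by fun_prop))]
  congr 1
  ext x
  simp [abs_div, abs_of_pos hs, div_le_div_iff_of_pos_right hs]

theorem stmt_10 (ε : ℝ) (v : NNReal) (hv : 0 < v) (α : ℝ) (hα : 0 ≤ α) (β : ℝ) :
    ((gaussianReal ε v) {x : ℝ | |x - ε| ≤ α}).toReal ≥ β ↔
      stdGaussianCDF (α / Real.sqrt v) ≥ (1 + β) / 2 := by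
  rw [← measureReal_def, gaussianReal_real_abs_sub_le ε hv.ne' α,
    gaussianReal_real_abs_le (by positivity)]
  constructor <;> intro h <;> linarith
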